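/- Fix γ ∈ (0,1]. Then φ_γ is differentiable on [−1,1], it is (3/γ)-Lipschitz, i.e. |φ_γ(s) − φ_γ(t)| ≤ (3/γ)|s − t| for all s, t ∈ [−1,1], and it is (3/γ²)-smooth and (1/4)-strongly convex, i.e. for all x, y ∈ [−1,1]: φ_γ'(x)(y−x) + (1/8)(y−x)² ≤ φ_γ(y) − φ_γ(x) ≤ φ_γ'(x)(y−x) + (3/(2γ²))(y−x)². -/

import Mathlib

/-- The piecewise part `ψ` of the loss: `ψ(t) = 1 - 2t/γ` for `t ≤ 0`,
`ψ(t) = (t-γ)²/γ²` for `0 ≤ t ≤ γ`, and `ψ(t) = 0` for `t ≥ γ`. -/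
noncomputable def psiLoss (γ t : ℝ) : ℝ :=
  if t ≤ 0 then 1 - 2 * t / γ else if t ≤ γ then (t - γ) ^ 2 / γ ^ 2 else 0

/-- The loss `φ_γ(t) = (1-t)²/8 + ψ(t)`. -/
noncomputable def phiLoss (γ t : ℝ) : ℝ := (1 - t) ^ 2 / 8 + psiLoss γ t

/-- The projection of `γ - t` onto `[0, γ]`; the derivative of `ψ` is `-2 / γ ^ 2` times it. -/
noncomputable def psiSlope (γ t : ℝ) : ℝ := max 0 (min γ (γ - t))

lemma psiSlope_nonneg (γ t : ℝ) : 0 ≤ psiSlope γ t := le_max_left _ _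

lemma psiSlope_le {γ : ℝ} (hγ : 0 ≤ γ) (t : ℝ) : psiSlope γ t ≤ γ :=
  max_le hγ (min_le_left _ _)

/-- The variational inequality characterising the projection onto `[0, γ]`. -/
lemma psiSlope_variational {γ k : ℝ} (hk0 : 0 ≤ k) (hkγ : k ≤ γ) (t : ℝ) :
    (γ - t - psiSlope γ t) * (k - psiSlope γ t) ≤ 0 := by
  unfold psiSlope
  rcases le_total γ (γ - t) with h | h
  · rw [min_eq_left h, max_eq_right (hk0.trans hkγ)]
    nlinarith
  · rw [min_eq_right h]
    rcases le_total 0 (γ - t) with h' | h'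
    · simp [max_eq_right h']
    · rw [max_eq_left h']
      nlinarith

lemma psiLoss_eq_psiSlope {γ : ℝ} (hγ : 0 < γ) (t : ℝ) :
    psiLoss γ t = (2 * psiSlope γ t * (γ - t) - psiSlope γ t ^ 2) / γ ^ 2 := by
  unfold psiLoss psiSlope
  split_ifs with h h'
  · rw [min_eq_left (by linarith), max_eq_right hγ.le]
    field_simp
    ring
  · rw [min_eq_right (by linarith), max_eq_right (by linarith)]
    ring
  · rw [min_eq_right (by linarith), max_eq_left (by linarith)]
    simp

lemma psiLoss_le_sub {γ : ℝ} (hγ : 0 < γ) (x y : ℝ) :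
    -(2 * psiSlope γ x / γ ^ 2) * (y - x) ≤ psiLoss γ y - psiLoss γ x := by
  have h := psiSlope_variational (psiSlope_nonneg γ x) (psiSlope_le hγ.le x) y
  rw [psiLoss_eq_psiSlope hγ, psiLoss_eq_psiSlope hγ, ← sub_div, neg_mul, div_mul_eq_mul_div,
    ← neg_div]
  gcongr
  nlinarith [sq_nonneg (psiSlope γ y - psiSlope γ x)]

lemma psiLoss_sub_le {γ : ℝ} (hγ : 0 < γ) (x y : ℝ) :
    psiLoss γ y - psiLoss γ x ≤
      -(2 * psiSlope γ x / γ ^ 2) * (y - x) + 1 / γ ^ 2 * (y - x) ^ 2 := by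
  have h := psiSlope_variational (psiSlope_nonneg γ y) (psiSlope_le hγ.le y) x
  rw [psiLoss_eq_psiSlope hγ, psiLoss_eq_psiSlope hγ, ← sub_div, neg_mul, div_mul_eq_mul_div,
    ← neg_div, div_mul_eq_mul_div, ← add_div]
  gcongr
  nlinarith [sq_nonneg (psiSlope γ y - psiSlope γ x - (x - y))]

/-- A first-order expansion with quadratic error determines the derivative. -/
lemma hasDerivAt_of_abs_sub_le_sq {f : ℝ → ℝ} {f' x C : ℝ}
    (h : ∀ y, |f y - f x - f' * (y - x)| ≤ C * (y - x) ^ 2) : HasDerivAt f f' x := by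
  rw [hasDerivAt_iff_isLittleO]
  have hO : (fun y => f y - f x - (y - x) • f') =O[nhds x] fun y => (y - x) ^ 2 :=
    Asymptotics.IsBigO.of_bound C <| Filter.Eventually.of_forall fun y => by
      simpa [mul_comm] using h y
  exact hO.trans_isLittleO (by simpa using Asymptotics.isLittleO_pow_sub_sub x one_lt_two)

lemma hasDerivAt_psiLoss {γ : ℝ} (hγ : 0 < γ) (x : ℝ) :
    HasDerivAt (psiLoss γ) (-(2 * psiSlope γ x / γ ^ 2)) x :=
  hasDerivAt_of_abs_sub_le_sq (C := 1 / γ ^ 2) fun y => by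
    rw [abs_of_nonneg (by linarith [psiLoss_le_sub hγ x y])]
    linarith [psiLoss_sub_le hγ x y]

lemma hasDerivAt_phiLoss {γ : ℝ} (hγ : 0 < γ) (x : ℝ) :
    HasDerivAt (phiLoss γ) (-(1 - x) / 4 - 2 * psiSlope γ x / γ ^ 2) x := by
  have h := ((((hasDerivAt_id x).const_sub 1).pow 2).div_const 8).add (hasDerivAt_psiLoss hγ x)
  exact h.congr_deriv (by simp; ring)

lemma phiLoss_le_sub {γ : ℝ} (hγ : 0 < γ) (x y : ℝ) :
    deriv (phiLoss γ) x * (y - x) + 1 / 8 * (y - x) ^ 2 ≤ phiLoss γ y - phiLoss γ x := by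
  rw [(hasDerivAt_phiLoss hγ x).deriv]
  unfold phiLoss
  linarith [psiLoss_le_sub hγ x y]

lemma phiLoss_sub_le {γ : ℝ} (hγ0 : 0 < γ) (hγ1 : γ ≤ 1) (x y : ℝ) :
    phiLoss γ y - phiLoss γ x ≤
      deriv (phiLoss γ) x * (y - x) + 3 / (2 * γ ^ 2) * (y - x) ^ 2 := by
  rw [(hasDerivAt_phiLoss hγ0 x).deriv]
  have hC : 1 / 8 + 1 / γ ^ 2 ≤ 3 / (2 * γ ^ 2) := by
    have h1 : 1 ≤ 1 / γ ^ 2 := one_le_one_div (by positivity) (pow_le_one₀ hγ0.le hγ1)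
    have h2 : 3 / (2 * γ ^ 2) = 3 / 2 * (1 / γ ^ 2) := by field_simp
    linarith
  have h := mul_le_mul_of_nonneg_right hC (sq_nonneg (y - x))
  unfold phiLoss
  linarith [psiLoss_sub_le hγ0 x y]

lemma abs_deriv_phiLoss_le {γ : ℝ} (hγ0 : 0 < γ) (hγ1 : γ ≤ 1) {x : ℝ}
    (hx : x ∈ Set.Icc (-1 : ℝ) 1) : |deriv (phiLoss γ) x| ≤ 3 / γ := by
  obtain ⟨hx0, hx1⟩ := hx
  rw [(hasDerivAt_phiLoss hγ0 x).deriv]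
  have h0 : 0 ≤ 2 * psiSlope γ x / γ ^ 2 := by
    have := psiSlope_nonneg γ x
    positivity
  have h1 : 2 * psiSlope γ x / γ ^ 2 ≤ 2 * (1 / γ) := by
    calc 2 * psiSlope γ x / γ ^ 2 ≤ 2 * γ / γ ^ 2 := by
          gcongr
          exact psiSlope_le hγ0.le x
      _ = 2 * (1 / γ) := by field_simp
  have h2 : 1 ≤ 1 / γ := one_le_one_div hγ0 hγ1
  have h3 : 3 / γ = 3 * (1 / γ) := by ring
  rw [abs_le]
  constructor <;> linarith

lemma phiLoss_sub_le_lipschitz {γ : ℝ} (hγ0 : 0 < γ) (hγ1 : γ ≤ 1) {x : ℝ}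
    (hx : x ∈ Set.Icc (-1 : ℝ) 1) (y : ℝ) :
    phiLoss γ x - phiLoss γ y ≤ 3 / γ * |x - y| := by
  have h : |deriv (phiLoss γ) x * (x - y)| ≤ 3 / γ * |x - y| := by
    rw [abs_mul]
    gcongr
    exact abs_deriv_phiLoss_le hγ0 hγ1 hx
  linarith [phiLoss_le_sub hγ0 x y, le_abs_self (deriv (phiLoss γ) x * (x - y)),
    sq_nonneg (y - x)]

/-- `φ_γ` is differentiable on `[-1,1]`, it is `(3/γ)`-Lipschitz there, and it is
`(3/γ²)`-smooth and `(1/4)`-strongly convex: for all `x, y ∈ [-1,1]`,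
`φ_γ'(x)(y-x) + (1/8)(y-x)² ≤ φ_γ(y) - φ_γ(x) ≤ φ_γ'(x)(y-x) + (3/(2γ²))(y-x)²`. -/
theorem phiLoss_regularity (γ : ℝ) (hγ0 : 0 < γ) (hγ1 : γ ≤ 1) :
    (∀ t ∈ Set.Icc (-1 : ℝ) 1, DifferentiableAt ℝ (phiLoss γ) t) ∧
    (∀ s ∈ Set.Icc (-1 : ℝ) 1, ∀ t ∈ Set.Icc (-1 : ℝ) 1,
      |phiLoss γ s - phiLoss γ t| ≤ 3 / γ * |s - t|) ∧
    (∀ x ∈ Set.Icc (-1 : ℝ) 1, ∀ y ∈ Set.Icc (-1 : ℝ) 1,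
      deriv (phiLoss γ) x * (y - x) + 1 / 8 * (y - x) ^ 2 ≤ phiLoss γ y - phiLoss γ x ∧
      phiLoss γ y - phiLoss γ x ≤
        deriv (phiLoss γ) x * (y - x) + 3 / (2 * γ ^ 2) * (y - x) ^ 2) := by
  refine ⟨fun t _ => (hasDerivAt_phiLoss hγ0 t).differentiableAt, fun s hs t ht => ?_,
    fun x _ y _ => ⟨phiLoss_le_sub hγ0 x y, phiLoss_sub_le hγ0 hγ1 x y⟩⟩
  refine abs_sub_le_iff.2 ⟨phiLoss_sub_le_lipschitz hγ0 hγ1 hs t, ?_⟩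
  rw [abs_sub_comm s t]
  exact phiLoss_sub_le_lipschitz hγ0 hγ1 ht s
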